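/- Let ⟨A_n⟩_{n∈ω} and ⟨B_n⟩_{n∈ω} be families of sets such that all the sets A_n, B_n (n ∈ ω) are pairwise disjoint, and for each n ∈ ω let ⟨f_n, g_n⟩ be a surjection pair between A_n and A_{n+1} ∪ B_n. Then there exists a set C disjoint from ⋃_{n∈ω} B_n such that for every m ∈ ω there is a surjection pair between A_m and C ∪ ⋃_{n∈ω} B_{m+n}. -/

import Mathlib

/-- `f` is a partial surjection from the set `A` onto the set `B`:
its domain is a subset of `A` and its range is exactly `B`. -/
def IsPartialSurjOn {α : Type*} (f : α →. α) (A B : Set α) : Prop :=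
  f.Dom ⊆ A ∧ f.ran = B

/-- `⟨f, g⟩` is a surjection pair between the sets `A` and `B`. -/
def IsSurjPair {α : Type*} (f g : α →. α) (A B : Set α) : Prop :=
  IsPartialSurjOn f A B ∧ IsPartialSurjOn g B A

theorem IsPartialSurjOn.exists_injection {α : Type*} {f : α →. α} {A B : Set α}
    (h : IsPartialSurjOn f A B) : ∃ i : B → A, Function.Injective i := by
  have key : ∀ b : B, ∃ a : A, b.1 ∈ f a := by
    rintro ⟨b, hb⟩
    rw [← h.2] at hb
    obtain ⟨a, ha⟩ := hb
    exact ⟨⟨a, h.1 ((PFun.mem_dom f a).2 ⟨b, ha⟩)⟩, ha⟩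
  choose i hi using key
  refine ⟨i, fun x y hxy => Subtype.ext (Part.mem_unique (hi x) ?_)⟩
  rw [hxy]
  exact hi y

theorem IsSurjPair.exists_bijOn {α : Type*} {f g : α →. α} {A B : Set α}
    (h : IsSurjPair f g A B) : ∃ e : α → α, Set.BijOn e A B := by
  classical
  obtain ⟨i, hi⟩ := h.1.exists_injection
  obtain ⟨j, hj⟩ := h.2.exists_injection
  obtain ⟨e, he⟩ := Function.Embedding.schroeder_bernstein hj hi
  refine ⟨fun x => if hx : x ∈ A then e ⟨x, hx⟩ else x, fun x hx => ?_, fun x hx y hy hxy => ?_,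
    fun b hb => ?_⟩
  · simp [hx]
  · simp only [hx, hy, dif_pos] at hxy
    simpa using he.1 (Subtype.ext hxy)
  · obtain ⟨⟨a, ha⟩, hab⟩ := he.2 ⟨b, hb⟩
    exact ⟨a, ha, by simp [ha, hab]⟩

theorem isPartialSurjOn_res {α : Type*} {e : α → α} {A B : Set α} (h : e '' A = B) :
    IsPartialSurjOn (PFun.res e A) A B := by
  refine ⟨fun x hx => ?_, ?_⟩
  · obtain ⟨y, hy⟩ := (PFun.mem_dom _ _).1 hx
    exact ((PFun.mem_res _ _ _ _).1 hy).1
  · rw [← h]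
    ext b
    simp [PFun.ran, PFun.mem_res]

theorem Set.BijOn.exists_isSurjPair {α : Type*} {e : α → α} {A B : Set α}
    (h : Set.BijOn e A B) : ∃ u v : α →. α, IsSurjPair u v A B := by
  rcases isEmpty_or_nonempty α with _ | _
  · refine ⟨PFun.res e A, PFun.res e B, isPartialSurjOn_res h.image_eq, isPartialSurjOn_res ?_⟩
    exact Subsingleton.elim _ _
  · exact ⟨_, _, isPartialSurjOn_res h.image_eq,
      isPartialSurjOn_res (h.symm h.invOn_invFunOn.symm).image_eq⟩

/-- Bijections on pairwise disjoint sets glue to one map, which is the identity elsewhere. -/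
theorem exists_glued_bijOn {α : Type*} {A T : ℕ → Set α} (e : ℕ → α → α)
    (hA : Pairwise (Function.onFun Disjoint A)) (he : ∀ n, Set.BijOn (e n) (A n) (T n)) :
    ∃ h : α → α, (∀ n, Set.BijOn h (A n) (T n)) ∧ ∀ x, (∀ n, x ∉ A n) → h x = x := by
  classical
  refine ⟨fun x => if hx : ∃ n, x ∈ A n then e hx.choose x else x, fun n => ?_, fun x hx => ?_⟩
  · refine (he n).congr fun x hx => ?_
    have hex : ∃ n, x ∈ A n := ⟨n, hx⟩
    have hn : hex.choose = n := by
      by_contra hne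
      exact Set.disjoint_left.1 (hA hne) hex.choose_spec hx
    simp only [hex, dif_pos, hn]
  · exact dif_neg (by simpa using hx)

section Iterate

variable {α : Type*} {A B : ℕ → Set α} {h : α → α}

theorem bijOn_iterate (hAB : ∀ i j, Disjoint (A i) (B j))
    (hB : Pairwise (Function.onFun Disjoint B))
    (hbij : ∀ n, Set.BijOn h (A n) (A (n + 1) ∪ B n))
    (hfix : ∀ n, ∀ x ∈ B n, h x = x) (m k : ℕ) :
    Set.BijOn h^[k] (A m) (A (m + k) ∪ ⋃ j < k, B (m + j)) := by
  induction k with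
  | zero => simpa using Set.bijOn_id (A m)
  | succ k ih =>
    rw [Function.iterate_succ']
    refine Set.BijOn.comp ?_ ih
    have hid : Set.BijOn h (⋃ j < k, B (m + j)) (⋃ j < k, B (m + j)) := by
      refine (Set.bijOn_id _).congr fun x hx => ?_
      simp only [Set.mem_iUnion] at hx
      obtain ⟨j, _, hx⟩ := hx
      exact (hfix _ x hx).symm
    have hset : A (m + (k + 1)) ∪ ⋃ j < k + 1, B (m + j) =
        (A (m + k + 1) ∪ B (m + k)) ∪ ⋃ j < k, B (m + j) := by
      rw [Set.biUnion_lt_succ, ← add_assoc, Set.union_assoc, Set.union_comm (B (m + k))]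
    rw [hset]
    refine (hbij (m + k)).union hid ?_
    have hdisj : Disjoint (A (m + k)) (⋃ j < k, B (m + j)) := by
      simp only [Set.disjoint_iUnion_right]
      exact fun j _ => hAB _ _
    rw [Set.injOn_union hdisj]
    refine ⟨(hbij _).injOn, hid.injOn, fun x hx y hy hxy => ?_⟩
    have hx' := (hbij _).mapsTo hx
    have hy' := hid.mapsTo hy
    simp only [Set.mem_iUnion] at hy'
    obtain ⟨j, hj, hy'⟩ := hy'
    rw [hxy] at hx'
    rcases hx' with hx' | hx'
    · exact Set.disjoint_left.1 (hAB _ _) hx' hy'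
    · exact Set.disjoint_left.1 (hB (show m + k ≠ m + j by omega)) hx' hy'

theorem iterate_eq_of_le (hfix : ∀ n, ∀ x ∈ B n, h x = x) {x : α} {k l : ℕ} (hkl : k ≤ l)
    (hx : h^[k] x ∈ ⋃ n, B n) : h^[l] x = h^[k] x := by
  obtain ⟨d, rfl⟩ := Nat.exists_eq_add_of_le hkl
  obtain ⟨n, hn⟩ := Set.mem_iUnion.1 hx
  rw [add_comm, Function.iterate_add_apply]
  exact Function.iterate_fixed (hfix n _ hn) d

theorem exists_bijOn_limit (hAB : ∀ i j, Disjoint (A i) (B j))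
    (hB : Pairwise (Function.onFun Disjoint B))
    (hbij : ∀ n, Set.BijOn h (A n) (A (n + 1) ∪ B n))
    (hfix : ∀ n, ∀ x ∈ B n, h x = x) (m : ℕ) :
    ∃ φ : α → α, Set.BijOn φ (A m)
      ({x ∈ A 0 | ¬ ∃ k, h^[k] x ∈ ⋃ n, B n} ∪ ⋃ n, B (m + n)) := by
  classical
  have hW := bijOn_iterate hAB hB hbij hfix
  have hA {i : ℕ} {x : α} (hx : x ∈ A i) : x ∉ ⋃ n, B n := by
    simp only [Set.mem_iUnion, not_exists]
    exact fun j => Set.disjoint_left.1 (hAB i j) hx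
  let P : α → Prop := fun x => ∃ k, h^[k] x ∈ ⋃ n, B n
  have hP (y : α) : P (h^[m] y) ↔ P y := by
    constructor
    · rintro ⟨k, hk⟩
      exact ⟨k + m, by rwa [Function.iterate_add_apply]⟩
    · rintro ⟨k, hk⟩
      refine ⟨k, ?_⟩
      rwa [← Function.iterate_add_apply, iterate_eq_of_le hfix (Nat.le_add_right k m) hk]
  have hpre : ∀ x, ∃ y, x ∈ A m → y ∈ A 0 ∧ h^[m] y = x := by
    intro x
    by_cases hx : x ∈ A m
    · obtain ⟨y, hy, hyx⟩ := (hW 0 m).surjOn (Or.inl (by simpa using hx))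
      exact ⟨y, fun _ => ⟨hy, hyx⟩⟩
    · exact ⟨x, fun h' => absurd h' hx⟩
  choose q hq using hpre
  let φ : α → α := fun x => if hx : P x then h^[hx.choose] x else q x
  have hpos {x : α} (hx : P x) : ∃ k, φ x = h^[k] x ∧ h^[k] x ∈ ⋃ n, B n :=
    ⟨hx.choose, by simp only [φ, dif_pos hx], hx.choose_spec⟩
  have hneg {x : α} (hx : ¬ P x) : φ x = q x := by simp only [φ, dif_neg hx]
  refine ⟨φ, fun x hx => ?_, fun x hx y hy hxy => ?_, fun c hc => ?_⟩
  · by_cases hPx : P x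
    · obtain ⟨k, hk, hkB⟩ := hpos hPx
      rw [hk]
      rcases (hW m k).mapsTo hx with h' | h'
      · exact absurd hkB (hA h')
      · simp only [Set.mem_iUnion] at h'
        obtain ⟨j, _, hj⟩ := h'
        exact Or.inr (Set.mem_iUnion.2 ⟨j, hj⟩)
    · rw [hneg hPx]
      refine Or.inl ⟨(hq x hx).1, fun h' => hPx ?_⟩
      rw [← (hq x hx).2]
      exact (hP _).2 h'
  · by_cases hPx : P x <;> by_cases hPy : P y
    · obtain ⟨k, hk, hkB⟩ := hpos hPx
      obtain ⟨l, hl, hlB⟩ := hpos hPy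
      refine (hW m (max k l)).injOn hx hy ?_
      rw [iterate_eq_of_le hfix (le_max_left k l) hkB,
        iterate_eq_of_le hfix (le_max_right k l) hlB, ← hk, ← hl, hxy]
    · obtain ⟨k, hk, hkB⟩ := hpos hPx
      rw [← hk, hxy, hneg hPy] at hkB
      exact absurd hkB (hA (hq y hy).1)
    · obtain ⟨k, hk, hkB⟩ := hpos hPy
      rw [← hk, ← hxy, hneg hPx] at hkB
      exact absurd hkB (hA (hq x hx).1)
    · rw [hneg hPx, hneg hPy] at hxy
      rw [← (hq x hx).2, ← (hq y hy).2, hxy]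
  · rcases hc with ⟨hc, hPc⟩ | hc
    · have hcm : h^[m] c ∈ A m := by
        rcases (hW 0 m).mapsTo hc with h' | h'
        · simpa using h'
        · simp only [Set.mem_iUnion] at h'
          obtain ⟨j, _, hj⟩ := h'
          exact absurd ⟨m, Set.mem_iUnion.2 ⟨_, hj⟩⟩ hPc
      refine ⟨_, hcm, ?_⟩
      rw [hneg (mt (hP c).1 hPc)]
      exact (hW 0 m).injOn (hq _ hcm).1 hc (hq _ hcm).2
    · obtain ⟨n, hn⟩ := Set.mem_iUnion.1 hc
      have hcW : c ∈ A (m + (n + 1)) ∪ ⋃ j < n + 1, B (m + j) :=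
        Or.inr (Set.mem_biUnion (Nat.lt_succ_self n) hn)
      obtain ⟨x, hx, hxc⟩ := (hW m (n + 1)).surjOn hcW
      have hxB : h^[n + 1] x ∈ ⋃ n, B n := Set.mem_iUnion.2 ⟨_, hxc ▸ hn⟩
      obtain ⟨k, hk, hkB⟩ := hpos ⟨n + 1, hxB⟩
      refine ⟨x, hx, ?_⟩
      rw [hk, ← hxc]
      rcases le_total k (n + 1) with hle | hle
      · exact (iterate_eq_of_le hfix hle hkB).symm
      · exact iterate_eq_of_le hfix hle hxB

end Iterate

theorem stmt_6 {α : Type*} (A B : ℕ → Set α) (f g : ℕ → (α →. α))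
    (hdisj : Pairwise (Function.onFun Disjoint (Sum.elim A B : ℕ ⊕ ℕ → Set α)))
    (hfg : ∀ n, IsSurjPair (f n) (g n) (A n) (A (n + 1) ∪ B n)) :
    ∃ C : Set α, Disjoint C (⋃ n, B n) ∧
      ∀ m, ∃ u v : α →. α, IsSurjPair u v (A m) (C ∪ ⋃ n, B (m + n)) := by
  have hA : Pairwise (Function.onFun Disjoint A) := fun i j hij =>
    hdisj (i := Sum.inl i) (j := Sum.inl j) (by simpa using hij)
  have hB : Pairwise (Function.onFun Disjoint B) := fun i j hij =>
    hdisj (i := Sum.inr i) (j := Sum.inr j) (by simpa using hij)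
  have hAB : ∀ i j, Disjoint (A i) (B j) := fun i j =>
    hdisj (i := Sum.inl i) (j := Sum.inr j) (by simp)
  choose e he using fun n => (hfg n).exists_bijOn
  obtain ⟨h, hbij, hid⟩ := exists_glued_bijOn e hA he
  have hfix : ∀ n, ∀ x ∈ B n, h x = x := fun n x hx =>
    hid x fun i => Set.disjoint_right.1 (hAB i n) hx
  refine ⟨{x ∈ A 0 | ¬ ∃ k, h^[k] x ∈ ⋃ n, B n}, ?_, fun m => ?_⟩
  · exact (Set.disjoint_iUnion_right.2 (hAB 0)).mono_left (Set.sep_subset _ _)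
  · obtain ⟨φ, hφ⟩ := exists_bijOn_limit hAB hB hbij hfix m
    exact hφ.exists_isSurjPair
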